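/- Let n ∈ ℕ satisfy W_n = { ⟨m, ⌜φ⌝⟩ : φ an 𝓛-formula with free variables ⊆ {x} and Σ(n) ⊨ φ(x|m̄) }. Then M_{Σ(n)} ⊨ σ for every σ ∈ Σ(n). -/

import Mathlib

/-!
Formalization of the framework of "A machine that knows its own code" (S. Alexander).

The language 𝓛 is the language of Peano arithmetic (constant `0`, unary successor `S`,
binary `+` and `·`) extended by a unary modal operator `K`.
-/

/-- Terms of the language 𝓛 of Peano arithmetic (variables are indexed by `ℕ`). -/
inductive LTerm : Type
  | var : ℕ → LTerm
  | zero : LTerm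
  | succ : LTerm → LTerm
  | add : LTerm → LTerm → LTerm
  | mul : LTerm → LTerm → LTerm
  deriving DecidableEq

/-- Formulas of 𝓛: atomic equalities, falsum, implication, universal quantification,
and the modal operator `K`.  Other connectives and `∃` are defined below. -/
inductive LFormula : Type
  | eq : LTerm → LTerm → LFormula
  | falsum : LFormula
  | imp : LFormula → LFormula → LFormula
  | all : ℕ → LFormula → LFormula
  | K : LFormula → LFormula
  deriving DecidableEq

namespace LTerm

/-- Variables occurring in a term. -/
def fv : LTerm → Finset ℕ
  | var n => {n}
  | zero => ∅
  | succ t => t.fv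
  | add t u => t.fv ∪ u.fv
  | mul t u => t.fv ∪ u.fv

/-- Simultaneous substitution of terms for variables in a term. -/
def subst (s : ℕ → LTerm) : LTerm → LTerm
  | var n => s n
  | zero => zero
  | succ t => succ (t.subst s)
  | add t u => add (t.subst s) (u.subst s)
  | mul t u => mul (t.subst s) (u.subst s)

end LTerm

/-- The numeral `n̄` for a natural number `n`. -/
def numeral : ℕ → LTerm
  | 0 => LTerm.zero
  | n + 1 => LTerm.succ (numeral n)

namespace LFormula

/-- The free variables of a formula (the free variables of `K φ` are those of `φ`). -/
def fv : LFormula → Finset ℕ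
  | eq t u => t.fv ∪ u.fv
  | falsum => ∅
  | imp a b => a.fv ∪ b.fv
  | all x a => a.fv.erase x
  | K a => a.fv

/-- Simultaneous substitution of terms for the *free* variables of a formula
(bound variables are left untouched; the substitution is not capture-avoiding). -/
def subst (s : ℕ → LTerm) : LFormula → LFormula
  | eq t u => eq (t.subst s) (u.subst s)
  | falsum => falsum
  | imp a b => imp (a.subst s) (b.subst s)
  | all x a => all x (a.subst fun z => if z = x then LTerm.var x else s z)
  | K a => K (a.subst s)

end LFormula

/-- `subst1 x t φ` is `φ(x|t)`, the result of substituting the term `t` for the free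
occurrences of the variable `x` in `φ`. -/
def subst1 (x : ℕ) (t : LTerm) (φ : LFormula) : LFormula :=
  φ.subst fun z => if z = x then t else LTerm.var z

/-- `instNum s φ` is `φ^s`: the sentence obtained from `φ` by replacing each free
variable `x` of `φ` by the numeral for `s x`. -/
def instNum (s : ℕ → ℕ) (φ : LFormula) : LFormula :=
  φ.subst fun z => numeral (s z)

/-- `SubstitutableVar y x φ`: the variable `y` is substitutable for the variable `x`
in `φ` (no free occurrence of `x` lies within the scope of a quantifier binding `y`). -/
def SubstitutableVar (y x : ℕ) : LFormula → Prop
  | .eq _ _ => True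
  | .falsum => True
  | .imp a b => SubstitutableVar y x a ∧ SubstitutableVar y x b
  | .all z a => x ∉ (LFormula.all z a).fv ∨ (y ≠ z ∧ SubstitutableVar y x a)
  | .K a => SubstitutableVar y x a

/-- Correspondence of variables relative to a list of pairs of bound variables. -/
def VarCorr : List (ℕ × ℕ) → ℕ → ℕ → Prop
  | [], x, y => x = y
  | (a, b) :: Γ, x, y => (x = a ∧ y = b) ∨ (x ≠ a ∧ y ≠ b ∧ VarCorr Γ x y)

/-- Alpha-correspondence of terms relative to a list of pairs of bound variables. -/
def TermAlpha (Γ : List (ℕ × ℕ)) : LTerm → LTerm → Prop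
  | .var x, .var y => VarCorr Γ x y
  | .zero, .zero => True
  | .succ t, .succ u => TermAlpha Γ t u
  | .add t₁ t₂, .add u₁ u₂ => TermAlpha Γ t₁ u₁ ∧ TermAlpha Γ t₂ u₂
  | .mul t₁ t₂, .mul u₁ u₂ => TermAlpha Γ t₁ u₁ ∧ TermAlpha Γ t₂ u₂
  | _, _ => False

/-- Alpha-correspondence of formulas relative to a list of pairs of bound variables. -/
def FormulaAlpha : List (ℕ × ℕ) → LFormula → LFormula → Prop
  | Γ, .eq t₁ t₂, .eq u₁ u₂ => TermAlpha Γ t₁ u₁ ∧ TermAlpha Γ t₂ u₂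
  | _, .falsum, .falsum => True
  | Γ, .imp a₁ a₂, .imp b₁ b₂ => FormulaAlpha Γ a₁ b₁ ∧ FormulaAlpha Γ a₂ b₂
  | Γ, .all x a, .all y b => FormulaAlpha ((x, y) :: Γ) a b
  | Γ, .K a, .K b => FormulaAlpha Γ a b
  | _, _, _ => False

/-- `ψ` is an alphabetic variant of `φ`: `ψ` is obtained from `φ` by renaming bound
variables so as to respect the binding of the quantifiers. -/
def AlphaVariant (φ ψ : LFormula) : Prop := FormulaAlpha [] φ ψ

/-- Negation, defined from `→` and `⊥`. -/
def notF (φ : LFormula) : LFormula := LFormula.imp φ LFormula.falsum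

/-- Conjunction (defined connective). -/
def andF (φ ψ : LFormula) : LFormula := notF (LFormula.imp φ (notF ψ))

/-- Biconditional (defined connective). -/
def iffF (φ ψ : LFormula) : LFormula := andF (LFormula.imp φ ψ) (LFormula.imp ψ φ)

/-- Existential quantification (defined). -/
def exF (x : ℕ) (φ : LFormula) : LFormula := notF (LFormula.all x (notF φ))

/-- A canonical universal closure of a formula. -/
def uclose (φ : LFormula) : LFormula :=
  (φ.fv.sort (· ≤ ·)).foldr LFormula.all φ

/-- An 𝓛-structure: a first-order structure for the first-order part of 𝓛, together
with a truth assignment `satK s φ` for the purely modal formulas `K φ` at each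
assignment `s` into the universe (the three required constraints are singled out
in `IsLStructure` below). -/
structure LStructure where
  U : Type
  nonempty : Nonempty U
  zero : U
  succ : U → U
  add : U → U → U
  mul : U → U → U
  satK : (ℕ → U) → LFormula → Prop

namespace LStructure

/-- Value of a term under an assignment. -/
def evalT (M : LStructure) (s : ℕ → M.U) : LTerm → M.U
  | .var n => s n
  | .zero => M.zero
  | .succ t => M.succ (M.evalT s t)
  | .add t u => M.add (M.evalT s t) (M.evalT s u)
  | .mul t u => M.mul (M.evalT s t) (M.evalT s u)

/-- Satisfaction `M ⊨ φ[s]`, defined by the usual induction on formula complexity,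
with `M ⊨ (K φ)[s]` given by the structure's truth assignment `satK`. -/
def Sat (M : LStructure) : (ℕ → M.U) → LFormula → Prop
  | s, .eq t u => M.evalT s t = M.evalT s u
  | _, .falsum => False
  | s, .imp a b => M.Sat s a → M.Sat s b
  | s, .all x a => ∀ u : M.U, M.Sat (Function.update s x u) a
  | s, .K a => M.satK s a

/-- `M ⊨ φ`: `M ⊨ φ[s]` for every assignment `s`. -/
def Models (M : LStructure) (φ : LFormula) : Prop := ∀ s : ℕ → M.U, M.Sat s φ

end LStructure

/-- The three constraints making an `LStructure` a genuine 𝓛-structure of the base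
logic: (a) `satK s φ` depends only on the values of `s` on the free variables of `φ`;
(b) invariance under alphabetic variants; (c) weak substitution. -/
def IsLStructure (M : LStructure) : Prop :=
  (∀ (φ : LFormula) (s t : ℕ → M.U), (∀ x ∈ φ.fv, s x = t x) →
      (M.satK s φ ↔ M.satK t φ)) ∧
  (∀ (φ ψ : LFormula) (s : ℕ → M.U), AlphaVariant φ ψ →
      (M.satK s φ ↔ M.satK s ψ)) ∧
  (∀ (φ : LFormula) (x y : ℕ) (s : ℕ → M.U), SubstitutableVar y x φ →
      (M.satK s (subst1 x (LTerm.var y) φ) ↔ M.satK (Function.update s x (s y)) φ))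

/-- `Σ ⊨ φ`: every 𝓛-structure satisfying every member of `Σ` satisfies `φ`. -/
def Consequence (T : Set LFormula) (φ : LFormula) : Prop :=
  ∀ M : LStructure, IsLStructure M → (∀ σ ∈ T, M.Models σ) → M.Models φ

/-- `φ` is valid: `∅ ⊨ φ`, i.e. `φ` holds in every 𝓛-structure under every assignment. -/
def Valid (φ : LFormula) : Prop := Consequence ∅ φ

/-- The structure `M_Σ`: universe `ℕ`, standard interpretations of the symbols of
Peano arithmetic, and `M_Σ ⊨ (K φ)[s]` iff `Σ ⊨ φ^s`. -/
def MSigma (T : Set LFormula) : LStructure where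
  U := ℕ
  nonempty := ⟨0⟩
  zero := 0
  succ := Nat.succ
  add := (· + ·)
  mul := (· * ·)
  satK := fun s φ => Consequence T (instNum s φ)

/-- Instances of the schema `E1`: the universal closure of `K φ` for valid `φ`. -/
def E1set : Set LFormula :=
  {χ | ∃ φ : LFormula, Valid φ ∧ χ = uclose (LFormula.K φ)}

/-- Instances of the schema `E2`: the universal closure of `K(φ → ψ) → K φ → K ψ`. -/
def E2set : Set LFormula :=
  {χ | ∃ φ ψ : LFormula,
    χ = uclose (LFormula.imp (LFormula.K (LFormula.imp φ ψ))
      (LFormula.imp (LFormula.K φ) (LFormula.K ψ)))}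

/-- Instances of the schema `E3` (factivity): the universal closure of `K φ → φ`. -/
def E3set : Set LFormula :=
  {χ | ∃ φ : LFormula, χ = uclose (LFormula.imp (LFormula.K φ) φ)}

/-- Instances of the schema `E4`: the universal closure of `K φ → K K φ`. -/
def E4set : Set LFormula :=
  {χ | ∃ φ : LFormula, χ = uclose (LFormula.imp (LFormula.K φ) (LFormula.K (LFormula.K φ)))}

/-- The axioms of Peano arithmetic for 𝓛: the six usual axioms for successor,
addition and multiplication, and the induction schema extended to all 𝓛-formulas. -/
inductive PAax : LFormula → Prop
  | succ_ne_zero : PAax (.all 0 (notF (.eq (.succ (.var 0)) .zero)))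
  | succ_inj : PAax (.all 0 (.all 1 (.imp (.eq (.succ (.var 0)) (.succ (.var 1)))
      (.eq (.var 0) (.var 1)))))
  | add_zero : PAax (.all 0 (.eq (.add (.var 0) .zero) (.var 0)))
  | add_succ : PAax (.all 0 (.all 1 (.eq (.add (.var 0) (.succ (.var 1)))
      (.succ (.add (.var 0) (.var 1))))))
  | mul_zero : PAax (.all 0 (.eq (.mul (.var 0) .zero) .zero))
  | mul_succ : PAax (.all 0 (.all 1 (.eq (.mul (.var 0) (.succ (.var 1)))
      (.add (.mul (.var 0) (.var 1)) (.var 0)))))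
  | ind (φ : LFormula) (x : ℕ) :
      PAax (uclose (.imp (subst1 x .zero φ)
        (.imp (.all x (.imp φ (subst1 x (.succ (.var x)) φ))) (.all x φ))))

/-- The set of axioms of Peano arithmetic for 𝓛. -/
def PAset : Set LFormula := {φ | PAax φ}

/-- `W e`: the `e`-th recursively enumerable subset of `ℕ` (the domain of the `e`-th
partial computable function). -/
def W (e : ℕ) : Set ℕ :=
  {m | ((Denumerable.ofNat Nat.Partrec.Code e).eval m).Dom}

namespace LTerm

/-- A canonical Gödel numbering of terms. -/
def gnum : LTerm → ℕ
  | var n => Nat.pair 0 n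
  | zero => Nat.pair 1 0
  | succ t => Nat.pair 2 t.gnum
  | add t u => Nat.pair 3 (Nat.pair t.gnum u.gnum)
  | mul t u => Nat.pair 4 (Nat.pair t.gnum u.gnum)

end LTerm

namespace LFormula

/-- A canonical Gödel numbering `⌜φ⌝` of formulas. -/
def gnum : LFormula → ℕ
  | eq t u => Nat.pair 0 (Nat.pair t.gnum u.gnum)
  | falsum => Nat.pair 1 0
  | imp a b => Nat.pair 2 (Nat.pair a.gnum b.gnum)
  | all x a => Nat.pair 3 (Nat.pair x a.gnum)
  | K a => Nat.pair 4 a.gnum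

end LFormula

/-- The designated variable `x`. -/
def vx : ℕ := 0
/-- The designated variable `y` (second pairing argument). -/
def vy : ℕ := 1
/-- The designated variable `e` (r.e. index). -/
def ve : ℕ := 2

/-- A formula is `K`-free (purely first-order) if the operator `K` does not occur in it. -/
def KFree : LFormula → Prop
  | .eq _ _ => True
  | .falsum => True
  | .imp a b => KFree a ∧ KFree b
  | .all _ a => KFree a
  | .K _ => False

/-- The standard structure: universe `ℕ` with the standard interpretations of the
symbols of Peano arithmetic (the modal component is irrelevant for `K`-free formulas). -/
def StdModel : LStructure where
  U := ℕ
  nonempty := ⟨0⟩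
  zero := 0
  succ := Nat.succ
  add := (· + ·)
  mul := (· * ·)
  satK := fun _ _ => False

/-- `pwNum pw a b k`: the result of substituting the numerals `ā`, `b̄`, `k̄` for the
designated variables `x`, `y`, `e` in the formula `pw` (read: `⟨ā, b̄⟩ ∈ W_k̄`). -/
def pwNum (pw : LFormula) (a b k : ℕ) : LFormula :=
  instNum (fun z => if z = vx then a else if z = vy then b else k) pw

/-- `wNum w a k`: the result of substituting the numerals `ā`, `k̄` for the designated
variables `x`, `e` in the formula `w` (read: `ā ∈ W_k̄`). -/
def wNum (w : LFormula) (a k : ℕ) : LFormula :=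
  instNum (fun z => if z = vx then a else k) w

/-- Line 3 of the definition of `Σ(n)`: the sentence
`∀x (K φ ↔ ⟨x, ⌜φ⌝⟩ ∈ W_n̄)`, where `pw` is the formula (with designated free
variables `x`, `y`, `e`) expressing `⟨x, y⟩ ∈ W_e`. -/
def line3 (pw : LFormula) (n : ℕ) (φ : LFormula) : LFormula :=
  LFormula.all vx (iffF (LFormula.K φ)
    (subst1 ve (numeral n) (subst1 vy (numeral φ.gnum) pw)))

/-- Membership in the axiom set `Σ(n)` (relative to the formula `pw` expressing
`⟨x, y⟩ ∈ W_e`): (1) instances of `E1`, `E2`, `E4`; (2) the axioms of Peano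
arithmetic for 𝓛; (3) `∀x (K φ ↔ ⟨x, ⌜φ⌝⟩ ∈ W_n̄)` for `φ` with free variables
⊆ {x}; (4) assigned validity `φ^s` for valid `φ`; (5) `K φ` for `φ` an instance of
lines 1–4 or, recursively, of line 5. -/
inductive SigmaAx (pw : LFormula) (n : ℕ) : LFormula → Prop
  | e1 {χ : LFormula} (h : χ ∈ E1set) : SigmaAx pw n χ
  | e2 {χ : LFormula} (h : χ ∈ E2set) : SigmaAx pw n χ
  | e4 {χ : LFormula} (h : χ ∈ E4set) : SigmaAx pw n χ
  | pa {χ : LFormula} (h : PAax χ) : SigmaAx pw n χ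
  | code (φ : LFormula) (h : φ.fv ⊆ {vx}) : SigmaAx pw n (line3 pw n φ)
  | av (φ : LFormula) (s : ℕ → ℕ) (h : Valid φ) : SigmaAx pw n (instNum s φ)
  | k {φ : LFormula} (h : SigmaAx pw n φ) : SigmaAx pw n (LFormula.K φ)

/-- The axiom set `Σ(n)` (relative to `pw`). -/
def SigmaN (pw : LFormula) (n : ℕ) : Set LFormula := {φ | SigmaAx pw n φ}

/-- The set `{ ⟨m, ⌜φ⌝⟩ : φ an 𝓛-formula with free variables ⊆ {x} and
Σ(n) ⊨ φ(x|m̄) }`. -/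
def goalSet (pw : LFormula) (n : ℕ) : Set ℕ :=
  {p | ∃ (m : ℕ) (φ : LFormula), p = Nat.pair m φ.gnum ∧ φ.fv ⊆ {vx} ∧
    Consequence (SigmaN pw n) (subst1 vx (numeral m) φ)}

namespace LTerm

theorem subst_congr {t : LTerm} {σ τ : ℕ → LTerm} (h : ∀ p ∈ t.fv, σ p = τ p) :
    t.subst σ = t.subst τ := by
  induction t <;> simp_all [fv, subst]

theorem subst_var (t : LTerm) : t.subst var = t := by
  induction t <;> simp_all [subst]

theorem subst_subst (t : LTerm) (σ ρ : ℕ → LTerm) :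
    (t.subst σ).subst ρ = t.subst fun z => (σ z).subst ρ := by
  induction t <;> simp_all [subst]

theorem exists_of_mem_fv_subst {t : LTerm} {σ : ℕ → LTerm} {p : ℕ} (h : p ∈ (t.subst σ).fv) :
    ∃ q ∈ t.fv, p ∈ (σ q).fv := by
  induction t with
  | var n => exact ⟨n, by simp [fv], h⟩
  | zero => simp [subst, fv] at h
  | succ t ih => exact ih h
  | add t u iht ihu | mul t u iht ihu =>
    simp only [subst, fv, Finset.mem_union] at h ⊢
    rcases h with h | h
    · obtain ⟨q, hq, hp⟩ := iht h
      exact ⟨q, Or.inl hq, hp⟩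
    · obtain ⟨q, hq, hp⟩ := ihu h
      exact ⟨q, Or.inr hq, hp⟩

theorem gnum_injective : Function.Injective gnum := by
  intro t
  induction t with
  | var n => intro u h; cases u <;> simp_all [gnum, Nat.pair_eq_pair]
  | zero => intro u h; cases u <;> simp_all [gnum, Nat.pair_eq_pair]
  | succ t ih =>
    intro u h
    cases u <;> simp only [gnum, Nat.pair_eq_pair] at h <;> try omega
    rw [ih h.2]
  | add t₁ t₂ ih₁ ih₂ | mul t₁ t₂ ih₁ ih₂ =>
    intro u h
    cases u <;> simp only [gnum, Nat.pair_eq_pair] at h <;> try omega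
    rw [ih₁ h.2.1, ih₂ h.2.2]

end LTerm

theorem numeral_fv (n : ℕ) : (numeral n).fv = ∅ := by
  induction n <;> simp_all [numeral, LTerm.fv]

theorem numeral_subst (n : ℕ) (σ : ℕ → LTerm) : (numeral n).subst σ = numeral n := by
  induction n <;> simp_all [numeral, LTerm.subst]

namespace LFormula

theorem subst_congr {φ : LFormula} {σ τ : ℕ → LTerm} (h : ∀ p ∈ φ.fv, σ p = τ p) :
    φ.subst σ = φ.subst τ := by
  induction φ generalizing σ τ with
  | eq t u =>
    simp only [fv, Finset.mem_union] at h
    simp only [subst]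
    rw [LTerm.subst_congr fun p hp => h p (Or.inl hp),
      LTerm.subst_congr fun p hp => h p (Or.inr hp)]
  | falsum => rfl
  | imp a b iha ihb =>
    simp only [fv, Finset.mem_union] at h
    simp only [subst]
    rw [iha fun p hp => h p (Or.inl hp), ihb fun p hp => h p (Or.inr hp)]
  | all x a ih =>
    simp only [subst]
    rw [ih]
    intro p hp
    by_cases hx : p = x
    · simp [hx]
    · simpa [hx] using h p (by simp [fv, hx, hp])
  | K a ih => exact congrArg K (ih h)

theorem subst_var (φ : LFormula) : φ.subst LTerm.var = φ := by
  induction φ with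
  | eq t u => simp [subst, LTerm.subst_var]
  | falsum => rfl
  | imp a b iha ihb => simp [subst, iha, ihb]
  | all x a ih =>
    simp only [subst]
    conv_rhs => rw [← ih]
    congr 2
    funext z
    split_ifs with h <;> simp [h]
  | K a ih => simp [subst, ih]

theorem exists_of_mem_fv_subst {φ : LFormula} {σ : ℕ → LTerm} {p : ℕ}
    (h : p ∈ (φ.subst σ).fv) : ∃ q ∈ φ.fv, p ∈ (σ q).fv := by
  induction φ generalizing σ with
  | eq t u =>
    simp only [subst, fv, Finset.mem_union] at h ⊢
    rcases h with h | h
    · obtain ⟨q, hq, hp⟩ := LTerm.exists_of_mem_fv_subst h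
      exact ⟨q, Or.inl hq, hp⟩
    · obtain ⟨q, hq, hp⟩ := LTerm.exists_of_mem_fv_subst h
      exact ⟨q, Or.inr hq, hp⟩
  | falsum => simp [subst, fv] at h
  | imp a b iha ihb =>
    simp only [subst, fv, Finset.mem_union] at h ⊢
    rcases h with h | h
    · obtain ⟨q, hq, hp⟩ := iha h
      exact ⟨q, Or.inl hq, hp⟩
    · obtain ⟨q, hq, hp⟩ := ihb h
      exact ⟨q, Or.inr hq, hp⟩
  | all x a ih =>
    simp only [subst, fv, Finset.mem_erase] at h ⊢
    obtain ⟨q, hq, hp⟩ := ih h.2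
    by_cases hx : q = x
    · simp only [hx, if_true, LTerm.fv, Finset.mem_singleton] at hp
      exact absurd hp h.1
    · exact ⟨q, ⟨hx, hq⟩, by simpa [hx] using hp⟩
  | K a ih => exact ih h

theorem gnum_injective : Function.Injective gnum := by
  intro φ
  induction φ with
  | eq t u =>
    intro ψ h
    cases ψ <;> simp only [gnum, Nat.pair_eq_pair] at h <;> try omega
    rw [LTerm.gnum_injective h.2.1, LTerm.gnum_injective h.2.2]
  | falsum => intro ψ h; cases ψ <;> simp_all [gnum, Nat.pair_eq_pair]
  | imp a b iha ihb =>
    intro ψ h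
    cases ψ <;> simp only [gnum, Nat.pair_eq_pair] at h <;> try omega
    rw [iha h.2.1, ihb h.2.2]
  | all x a ih =>
    intro ψ h
    cases ψ <;> simp only [gnum, Nat.pair_eq_pair] at h <;> try omega
    rw [h.2.1, ih h.2.2]
  | K a ih =>
    intro ψ h
    cases ψ <;> simp only [gnum, Nat.pair_eq_pair] at h <;> try omega
    rw [ih h.2]

/-- The variables bound by a quantifier in a formula. -/
def bv : LFormula → Finset ℕ
  | eq _ _ => ∅
  | falsum => ∅
  | imp a b => a.bv ∪ b.bv
  | all x a => insert x a.bv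
  | K a => a.bv

/-- No variable of a substituted term gets captured by a quantifier. -/
def NoCapture : (ℕ → LTerm) → LFormula → Prop
  | _, eq _ _ => True
  | _, falsum => True
  | σ, imp a b => NoCapture σ a ∧ NoCapture σ b
  | σ, all x a => (∀ p ∈ a.fv, p ≠ x → x ∉ (σ p).fv) ∧
      NoCapture (fun z => if z = x then LTerm.var x else σ z) a
  | σ, K a => NoCapture σ a

theorem noCapture_of_fv_subset {φ : LFormula} {σ : ℕ → LTerm}
    (h : ∀ p ∈ φ.fv, (σ p).fv ⊆ {p}) : NoCapture σ φ := by
  induction φ generalizing σ with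
  | eq t u => trivial
  | falsum => trivial
  | imp a b iha ihb =>
    simp only [fv, Finset.mem_union] at h
    exact ⟨iha fun p hp => h p (Or.inl hp), ihb fun p hp => h p (Or.inr hp)⟩
  | all x a ih =>
    simp only [fv, Finset.mem_erase] at h
    refine ⟨fun p hp hpx hx => hpx ?_, ih fun p hp => ?_⟩
    · exact (Finset.mem_singleton.1 (h p ⟨hpx, hp⟩ hx)).symm
    · by_cases hx : p = x
      · simp [hx, LTerm.fv]
      · simpa [hx] using h p ⟨hx, hp⟩
  | K a ih => exact ih h

theorem noCapture_numeral (φ : LFormula) (s : ℕ → ℕ) : NoCapture (fun z => numeral (s z)) φ :=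
  noCapture_of_fv_subset fun p _ => by simp [numeral_fv]

theorem noCapture_subst1 (φ : LFormula) (x : ℕ) {t : LTerm} (ht : t.fv ⊆ {x}) :
    NoCapture (fun z => if z = x then t else LTerm.var z) φ :=
  noCapture_of_fv_subset fun p _ => by
    by_cases hx : p = x
    · simpa [hx] using ht
    · simp [hx, LTerm.fv]

theorem noCapture_of_substitutableVar {φ : LFormula} {x y : ℕ} (h : SubstitutableVar y x φ) :
    NoCapture (fun z => if z = x then LTerm.var y else LTerm.var z) φ := by
  induction φ with
  | eq t u => trivial
  | falsum => trivial
  | imp a b iha ihb => exact ⟨iha h.1, ihb h.2⟩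
  | all v a ih =>
    by_cases hx : x ∈ (LFormula.all v a).fv
    · obtain ⟨hyv, ha⟩ := h.resolve_left (not_not_intro hx)
      have hxv : x ≠ v := (Finset.mem_erase.1 hx).1
      refine ⟨fun p _ hpv => ?_, ?_⟩
      · by_cases hp : p = x
        · simpa [hp, LTerm.fv] using hyv.symm
        · simpa [hp, LTerm.fv] using hpv.symm
      · convert ih ha using 2 with z
        by_cases hz : z = v
        · simp [hz, hxv.symm]
        · simp [hz]
    · refine noCapture_of_fv_subset fun p hp => ?_
      have : p ≠ x := fun e => hx (e ▸ hp)
      simp [this, LTerm.fv]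
  | K a ih => exact ih h

theorem subst_subst {φ : LFormula} {σ : ℕ → LTerm} (ρ : ℕ → LTerm) (h : NoCapture σ φ) :
    (φ.subst σ).subst ρ = φ.subst fun z => (σ z).subst ρ := by
  induction φ generalizing σ ρ with
  | eq t u => simp [subst, LTerm.subst_subst]
  | falsum => rfl
  | imp a b iha ihb => simp only [subst]; rw [iha ρ h.1, ihb ρ h.2]
  | all x a ih =>
    simp only [subst]
    rw [ih _ h.2]
    congr 1
    refine subst_congr fun p hp => ?_
    by_cases hx : p = x
    · simp [hx, LTerm.subst]
    · simp only [hx, if_false]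
      refine LTerm.subst_congr fun q hq => ?_
      have : q ≠ x := fun e => h.1 p hp hx (e ▸ hq)
      simp [this]
  | K a ih => exact congrArg K (ih ρ h)

theorem substitutableVar_of_notMem_bv {φ : LFormula} {x y : ℕ} (h : y ∉ φ.bv) :
    SubstitutableVar y x φ := by
  induction φ with
  | eq t u => trivial
  | falsum => trivial
  | imp a b iha ihb =>
    simp only [bv, Finset.mem_union, not_or] at h
    exact ⟨iha h.1, ihb h.2⟩
  | all v a ih =>
    simp only [bv, Finset.mem_insert, not_or] at h
    exact Or.inr ⟨h.1, ih h.2⟩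
  | K a ih => exact ih h

theorem mem_fv_subst1_var {φ : LFormula} {x z p : ℕ} (h : p ∈ (subst1 x (LTerm.var z) φ).fv) :
    p = z ∨ (p ≠ x ∧ p ∈ φ.fv) := by
  obtain ⟨q, hq, hp⟩ := exists_of_mem_fv_subst h
  by_cases hx : q = x
  · simp only [hx, if_true, LTerm.fv, Finset.mem_singleton] at hp
    exact Or.inl hp
  · simp only [hx, if_false, LTerm.fv, Finset.mem_singleton] at hp
    subst hp
    exact Or.inr ⟨hx, hq⟩

theorem fv_instNum (s : ℕ → ℕ) (φ : LFormula) : (instNum s φ).fv = ∅ := by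
  refine Finset.eq_empty_of_forall_notMem fun p hp => ?_
  obtain ⟨q, _, hq⟩ := exists_of_mem_fv_subst hp
  simp [numeral_fv] at hq

theorem instNum_of_fv_eq_empty {φ : LFormula} (h : φ.fv = ∅) (s : ℕ → ℕ) : instNum s φ = φ := by
  conv_rhs => rw [← subst_var φ]
  exact subst_congr fun p hp => by simp [h] at hp

theorem instNum_subst1_var {φ : LFormula} {x y : ℕ} (h : SubstitutableVar y x φ) (s : ℕ → ℕ) :
    instNum s (subst1 x (LTerm.var y) φ) = instNum (Function.update s x (s y)) φ := by
  unfold instNum subst1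
  rw [subst_subst _ (noCapture_of_substitutableVar h)]
  refine subst_congr fun p _ => ?_
  by_cases hx : p = x
  · simp [hx, LTerm.subst]
  · simp [hx, LTerm.subst]

theorem fv_foldr_all (l : List ℕ) (φ : LFormula) : (l.foldr all φ).fv = φ.fv \ l.toFinset := by
  induction l with
  | nil => simp
  | cons x l ih =>
    ext p
    simp only [List.foldr_cons, fv, ih, List.toFinset_cons, Finset.mem_erase, Finset.mem_sdiff,
      Finset.mem_insert]
    tauto

theorem fv_uclose (φ : LFormula) : (uclose φ).fv = ∅ := by
  simp [uclose, fv_foldr_all]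

theorem uclose_of_fv_eq_empty {φ : LFormula} (h : φ.fv = ∅) : uclose φ = φ := by
  simp [uclose, h]

theorem kFree_subst {φ : LFormula} (h : KFree φ) (σ : ℕ → LTerm) : KFree (φ.subst σ) := by
  induction φ generalizing σ with
  | eq t u => trivial
  | falsum => trivial
  | imp a b iha ihb => exact ⟨iha h.1 σ, ihb h.2 σ⟩
  | all x a ih => exact ih h _
  | K a ih => exact h.elim

end LFormula

open LFormula

section Alpha

theorem TermAlpha.cons {Γ : List (ℕ × ℕ)} {t u : LTerm} {x y : ℕ} (h : TermAlpha Γ t u)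
    (hx : x ∉ t.fv) (hy : y ∉ u.fv) : TermAlpha ((x, y) :: Γ) t u := by
  induction t generalizing u with
  | var p =>
    cases u <;> simp only [TermAlpha] at h ⊢
    simp only [LTerm.fv, Finset.mem_singleton] at hx hy
    exact Or.inr ⟨Ne.symm hx, Ne.symm hy, h⟩
  | zero => cases u <;> simp_all [TermAlpha]
  | succ t ih =>
    cases u <;> simp only [TermAlpha] at h ⊢
    exact ih h hx hy
  | add t₁ t₂ ih₁ ih₂ | mul t₁ t₂ ih₁ ih₂ =>
    cases u <;> simp only [TermAlpha] at h ⊢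
    simp only [LTerm.fv, Finset.mem_union, not_or] at hx hy
    exact ⟨ih₁ h.1 hx.1 hy.1, ih₂ h.2 hx.2 hy.2⟩

theorem TermAlpha.subst {Γ Δ : List (ℕ × ℕ)} {t u : LTerm} {σ τ : ℕ → LTerm}
    (h : TermAlpha Γ t u)
    (hστ : ∀ p ∈ t.fv, ∀ q ∈ u.fv, VarCorr Γ p q → TermAlpha Δ (σ p) (τ q)) :
    TermAlpha Δ (t.subst σ) (u.subst τ) := by
  induction t generalizing u with
  | var p =>
    cases u <;> simp only [TermAlpha] at h
    exact hστ _ (by simp [LTerm.fv]) _ (by simp [LTerm.fv]) h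
  | zero => cases u <;> simp_all [TermAlpha, LTerm.subst]
  | succ t ih =>
    cases u <;> simp only [TermAlpha] at h
    exact ih h hστ
  | add t₁ t₂ ih₁ ih₂ | mul t₁ t₂ ih₁ ih₂ =>
    cases u <;> simp only [TermAlpha] at h
    simp only [LTerm.fv, Finset.mem_union] at hστ
    exact ⟨ih₁ h.1 fun p hp q hq => hστ p (Or.inl hp) q (Or.inl hq),
      ih₂ h.2 fun p hp q hq => hστ p (Or.inr hp) q (Or.inr hq)⟩

theorem FormulaAlpha.subst {Γ Δ : List (ℕ × ℕ)} {a b : LFormula} {σ τ : ℕ → LTerm}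
    (h : FormulaAlpha Γ a b) (hσ : NoCapture σ a) (hτ : NoCapture τ b)
    (hστ : ∀ p ∈ a.fv, ∀ q ∈ b.fv, VarCorr Γ p q → TermAlpha Δ (σ p) (τ q)) :
    FormulaAlpha Δ (a.subst σ) (b.subst τ) := by
  induction a generalizing b Γ Δ σ τ with
  | eq t u =>
    cases b <;> simp only [FormulaAlpha] at h
    simp only [LFormula.fv, Finset.mem_union] at hστ
    exact ⟨h.1.subst fun p hp q hq => hστ p (Or.inl hp) q (Or.inl hq),
      h.2.subst fun p hp q hq => hστ p (Or.inr hp) q (Or.inr hq)⟩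
  | falsum => cases b <;> simp_all [FormulaAlpha, LFormula.subst]
  | imp a₁ a₂ ih₁ ih₂ =>
    cases b <;> simp only [FormulaAlpha] at h
    simp only [LFormula.fv, Finset.mem_union] at hστ
    exact ⟨ih₁ h.1 hσ.1 hτ.1 fun p hp q hq => hστ p (Or.inl hp) q (Or.inl hq),
      ih₂ h.2 hσ.2 hτ.2 fun p hp q hq => hστ p (Or.inr hp) q (Or.inr hq)⟩
  | all x a ih =>
    cases b <;> simp only [FormulaAlpha] at h
    simp only [LFormula.fv, Finset.mem_erase] at hστ
    refine ih h hσ.2 hτ.2 fun p hp q hq hpq => ?_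
    rcases hpq with ⟨rfl, rfl⟩ | ⟨hpx, hqy, hpq⟩
    · simp [TermAlpha, VarCorr]
    · simp only [hpx, hqy, if_false]
      exact (hστ p ⟨hpx, hp⟩ q ⟨hqy, hq⟩ hpq).cons (hσ.1 p hp hpx) (hτ.1 q hq hqy)
  | K a ih =>
    cases b <;> simp only [FormulaAlpha] at h
    exact ih h hσ hτ hστ

theorem TermAlpha.exists_of_mem_fv {Γ : List (ℕ × ℕ)} {t u : LTerm} (h : TermAlpha Γ t u) {q : ℕ}
    (hq : q ∈ u.fv) : ∃ p ∈ t.fv, VarCorr Γ p q := by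
  induction t generalizing u with
  | var p =>
    cases u <;> simp only [TermAlpha] at h
    simp only [LTerm.fv, Finset.mem_singleton] at hq
    subst hq
    exact ⟨p, by simp [LTerm.fv], h⟩
  | zero => cases u <;> simp_all [TermAlpha, LTerm.fv]
  | succ t ih =>
    cases u <;> simp only [TermAlpha] at h
    exact ih h hq
  | add t₁ t₂ ih₁ ih₂ | mul t₁ t₂ ih₁ ih₂ =>
    cases u <;> simp only [TermAlpha] at h
    simp only [LTerm.fv, Finset.mem_union] at hq ⊢
    rcases hq with hq | hq
    · obtain ⟨p, hp, hpq⟩ := ih₁ h.1 hq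
      exact ⟨p, Or.inl hp, hpq⟩
    · obtain ⟨p, hp, hpq⟩ := ih₂ h.2 hq
      exact ⟨p, Or.inr hp, hpq⟩

theorem FormulaAlpha.exists_of_mem_fv {Γ : List (ℕ × ℕ)} {a b : LFormula}
    (h : FormulaAlpha Γ a b) {q : ℕ} (hq : q ∈ b.fv) : ∃ p ∈ a.fv, VarCorr Γ p q := by
  induction a generalizing b Γ with
  | eq t u =>
    cases b <;> simp only [FormulaAlpha] at h
    simp only [LFormula.fv, Finset.mem_union] at hq ⊢
    rcases hq with hq | hq
    · obtain ⟨p, hp, hpq⟩ := h.1.exists_of_mem_fv hq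
      exact ⟨p, Or.inl hp, hpq⟩
    · obtain ⟨p, hp, hpq⟩ := h.2.exists_of_mem_fv hq
      exact ⟨p, Or.inr hp, hpq⟩
  | falsum => cases b <;> simp_all [FormulaAlpha, LFormula.fv]
  | imp a₁ a₂ ih₁ ih₂ =>
    cases b <;> simp only [FormulaAlpha] at h
    simp only [LFormula.fv, Finset.mem_union] at hq ⊢
    rcases hq with hq | hq
    · obtain ⟨p, hp, hpq⟩ := ih₁ h.1 hq
      exact ⟨p, Or.inl hp, hpq⟩
    · obtain ⟨p, hp, hpq⟩ := ih₂ h.2 hq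
      exact ⟨p, Or.inr hp, hpq⟩
  | all x a ih =>
    cases b <;> simp only [FormulaAlpha] at h
    simp only [LFormula.fv, Finset.mem_erase] at hq ⊢
    obtain ⟨p, hp, hpq⟩ := ih h hq.2
    rcases hpq with ⟨_, hqy⟩ | ⟨hpx, _, hpq⟩
    · exact absurd hqy hq.1
    · exact ⟨p, ⟨hpx, hp⟩, hpq⟩
  | K a ih =>
    cases b <;> simp only [FormulaAlpha] at h
    exact ih h hq

theorem termAlpha_numeral (Γ : List (ℕ × ℕ)) (n : ℕ) : TermAlpha Γ (numeral n) (numeral n) := by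
  induction n <;> simp_all [numeral, TermAlpha]

theorem AlphaVariant.instNum {φ ψ : LFormula} (h : AlphaVariant φ ψ) (s : ℕ → ℕ) :
    AlphaVariant (instNum s φ) (instNum s ψ) :=
  FormulaAlpha.subst h (noCapture_numeral _ _) (noCapture_numeral _ _) fun p _ q _ hpq => by
    have : p = q := hpq
    subst this
    exact termAlpha_numeral _ _

theorem varCorr_self {Γ : List (ℕ × ℕ)} {z : ℕ} (h₁ : z ∉ Γ.map Prod.fst)
    (h₂ : z ∉ Γ.map Prod.snd) : VarCorr Γ z z := by
  induction Γ with
  | nil => rfl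
  | cons c Γ ih =>
    simp only [List.map_cons, List.mem_cons, not_or] at h₁ h₂
    exact Or.inr ⟨h₁.1, h₂.1, ih h₁.2 h₂.2⟩

theorem VarCorr.eq_iff {Γ : List (ℕ × ℕ)} {z p q : ℕ} (h : VarCorr Γ p q)
    (h₁ : z ∉ Γ.map Prod.fst) (h₂ : z ∉ Γ.map Prod.snd) : p = z ↔ q = z := by
  induction Γ with
  | nil =>
    have : p = q := h
    rw [this]
  | cons c Γ ih =>
    simp only [List.map_cons, List.mem_cons, not_or] at h₁ h₂
    rcases h with ⟨rfl, rfl⟩ | ⟨_, _, h⟩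
    · exact iff_of_false (Ne.symm h₁.1) (Ne.symm h₂.1)
    · exact ih h h₁.2 h₂.2

end Alpha

namespace LStructure

variable {M : LStructure}

theorem evalT_congr {s t : ℕ → M.U} {u : LTerm} (h : ∀ p ∈ u.fv, s p = t p) :
    M.evalT s u = M.evalT t u := by
  induction u <;> simp_all [LTerm.fv, evalT]

theorem sat_congr (hM : IsLStructure M) {s t : ℕ → M.U} {φ : LFormula}
    (h : ∀ p ∈ φ.fv, s p = t p) : M.Sat s φ ↔ M.Sat t φ := by
  induction φ generalizing s t with
  | eq u v =>
    simp only [fv, Finset.mem_union] at h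
    simp only [Sat]
    rw [evalT_congr fun p hp => h p (Or.inl hp), evalT_congr fun p hp => h p (Or.inr hp)]
  | falsum => rfl
  | imp a b iha ihb =>
    simp only [fv, Finset.mem_union] at h
    exact imp_congr (iha fun p hp => h p (Or.inl hp)) (ihb fun p hp => h p (Or.inr hp))
  | all x a ih =>
    refine forall_congr' fun u => ih fun p hp => ?_
    by_cases hx : p = x
    · simp [hx]
    · simpa [hx] using h p (by simp [fv, hx, hp])
  | K a ih => exact hM.1 a s t h

theorem models_of_sat (hM : IsLStructure M) {s : ℕ → M.U} {φ : LFormula} (hφ : φ.fv = ∅)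
    (h : M.Sat s φ) : M.Models φ := fun t =>
  (sat_congr hM fun p hp => by simp [hφ] at hp).1 h

theorem models_uclose {φ : LFormula} (h : M.Models φ) : M.Models (uclose φ) := by
  unfold uclose
  induction φ.fv.sort (· ≤ ·) with
  | nil => exact h
  | cons x l ih => exact fun s u => ih _

theorem satK_alpha (hM : IsLStructure M) {Γ : List (ℕ × ℕ)} {a b : LFormula} {s t : ℕ → M.U}
    (h : FormulaAlpha Γ a b)
    (hst : ∀ p ∈ a.fv, ∀ q ∈ b.fv, VarCorr Γ p q → s p = t q) :
    M.satK s a ↔ M.satK t b := by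
  induction Γ generalizing a b s t with
  | nil =>
    refine (hM.2.1 a b s h).trans (hM.1 b s t fun q hq => ?_)
    obtain ⟨p, hp, hpq⟩ := h.exists_of_mem_fv hq
    have hpq' : p = q := hpq
    subst hpq'
    exact hst p hp p hq hpq
  | cons c Γ ih =>
    obtain ⟨x, y⟩ := c
    obtain ⟨z, hz⟩ := Infinite.exists_notMem_finset
      (a.bv ∪ b.bv ∪ a.fv ∪ b.fv ∪ (Γ.map Prod.fst).toFinset ∪ (Γ.map Prod.snd).toFinset)
    simp only [Finset.mem_union, List.mem_toFinset, not_or] at hz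
    obtain ⟨⟨⟨⟨⟨hza, hzb⟩, hzfa⟩, hzfb⟩, hz₁⟩, hz₂⟩ := hz
    have rename : ∀ {c : LFormula} {w : ℕ → M.U} {v : ℕ} (m : M.U), z ∉ c.bv → z ∉ c.fv →
        (v ∈ c.fv → m = w v) →
        (M.satK (Function.update w z m) (subst1 v (LTerm.var z) c) ↔ M.satK w c) := by
      intro c w v m hb hf hm
      rw [hM.2.2 c v z _ (substitutableVar_of_notMem_bv hb)]
      refine hM.1 _ _ _ fun p hp => ?_
      by_cases hpv : p = v
      · subst hpv
        simp [hm hp]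
      · have : p ≠ z := fun e => hf (e ▸ hp)
        simp [hpv, this]
    have hα : FormulaAlpha Γ (subst1 x (LTerm.var z) a) (subst1 y (LTerm.var z) b) := by
      refine h.subst (noCapture_of_substitutableVar (substitutableVar_of_notMem_bv hza))
        (noCapture_of_substitutableVar (substitutableVar_of_notMem_bv hzb)) ?_
      rintro p - q - (⟨rfl, rfl⟩ | ⟨hpx, hqy, hpq⟩)
      · simpa [TermAlpha] using varCorr_self hz₁ hz₂
      · simpa [hpx, hqy, TermAlpha] using hpq
    obtain ⟨m, hmx, hmy⟩ : ∃ m, (x ∈ a.fv → m = s x) ∧ (y ∈ b.fv → m = t y) := by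
      by_cases hx : x ∈ a.fv
      · exact ⟨s x, fun _ => rfl, fun hy => hst x hx y hy (Or.inl ⟨rfl, rfl⟩)⟩
      · exact ⟨t y, fun h => absurd h hx, fun _ => rfl⟩
    rw [← rename m hza hzfa hmx, ← rename m hzb hzfb hmy]
    refine ih hα fun p hp q hq hpq => ?_
    have hiff := hpq.eq_iff hz₁ hz₂
    by_cases hpz : p = z
    · simp [hpz, hiff.1 hpz]
    · have hqz : q ≠ z := fun e => hpz (hiff.2 e)
      obtain ⟨hpx, hp⟩ := (mem_fv_subst1_var hp).resolve_left hpz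
      obtain ⟨hqy, hq⟩ := (mem_fv_subst1_var hq).resolve_left hqz
      simpa [hpz, hqz] using hst p hp q hq (Or.inr ⟨hpx, hqy, hpq⟩)

theorem evalT_alpha {Γ : List (ℕ × ℕ)} {u v : LTerm} {s t : ℕ → M.U} (h : TermAlpha Γ u v)
    (hst : ∀ p ∈ u.fv, ∀ q ∈ v.fv, VarCorr Γ p q → s p = t q) :
    M.evalT s u = M.evalT t v := by
  induction u generalizing v with
  | var p =>
    cases v <;> simp only [TermAlpha] at h
    exact hst _ (by simp [LTerm.fv]) _ (by simp [LTerm.fv]) h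
  | zero => cases v <;> simp_all [TermAlpha, evalT]
  | succ u ih =>
    cases v <;> simp only [TermAlpha] at h
    exact congrArg M.succ (ih h hst)
  | add u₁ u₂ ih₁ ih₂ | mul u₁ u₂ ih₁ ih₂ =>
    cases v <;> simp only [TermAlpha] at h
    simp only [LTerm.fv, Finset.mem_union] at hst
    simp only [evalT]
    rw [ih₁ h.1 fun p hp q hq => hst p (Or.inl hp) q (Or.inl hq),
      ih₂ h.2 fun p hp q hq => hst p (Or.inr hp) q (Or.inr hq)]

theorem sat_alpha (hM : IsLStructure M) {Γ : List (ℕ × ℕ)} {a b : LFormula} {s t : ℕ → M.U}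
    (h : FormulaAlpha Γ a b)
    (hst : ∀ p ∈ a.fv, ∀ q ∈ b.fv, VarCorr Γ p q → s p = t q) :
    M.Sat s a ↔ M.Sat t b := by
  induction a generalizing b Γ s t with
  | eq u v =>
    cases b <;> simp only [FormulaAlpha] at h
    simp only [fv, Finset.mem_union] at hst
    simp only [Sat]
    rw [evalT_alpha h.1 fun p hp q hq => hst p (Or.inl hp) q (Or.inl hq),
      evalT_alpha h.2 fun p hp q hq => hst p (Or.inr hp) q (Or.inr hq)]
  | falsum => cases b <;> simp_all [FormulaAlpha, Sat]
  | imp a₁ a₂ ih₁ ih₂ =>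
    cases b <;> simp only [FormulaAlpha] at h
    simp only [fv, Finset.mem_union] at hst
    exact imp_congr (ih₁ h.1 fun p hp q hq => hst p (Or.inl hp) q (Or.inl hq))
      (ih₂ h.2 fun p hp q hq => hst p (Or.inr hp) q (Or.inr hq))
  | all x a ih =>
    cases b <;> simp only [FormulaAlpha] at h
    simp only [fv, Finset.mem_erase] at hst
    refine forall_congr' fun u => ih h fun p hp q hq hpq => ?_
    rcases hpq with ⟨rfl, rfl⟩ | ⟨hpx, hqy, hpq⟩
    · simp
    · simpa [hpx, hqy] using hst p ⟨hpx, hp⟩ q ⟨hqy, hq⟩ hpq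
  | K a ih =>
    cases b <;> simp only [FormulaAlpha] at h
    exact satK_alpha hM h hst

theorem models_alphaVariant (hM : IsLStructure M) {φ ψ : LFormula} (h : AlphaVariant φ ψ) :
    M.Models φ ↔ M.Models ψ :=
  forall_congr' fun s => sat_alpha hM h fun _ _ _ _ hpq => congrArg s hpq

/-- The ultraproduct of a family of structures. -/
noncomputable def ultraproduct {I : Type} (F : Ultrafilter I) (N : I → LStructure) :
    LStructure where
  U := (F : Filter I).Product fun i => (N i).U
  nonempty := ⟨Quotient.mk _ fun i => (N i).nonempty.some⟩
  zero := Quotient.mk _ fun i => (N i).zero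
  succ a := Quotient.mk _ fun i => (N i).succ (a.out i)
  add a b := Quotient.mk _ fun i => (N i).add (a.out i) (b.out i)
  mul a b := Quotient.mk _ fun i => (N i).mul (a.out i) (b.out i)
  satK s φ := ∀ᶠ i in F, (N i).satK (fun v => (s v).out i) φ

section Ultraproduct

variable {I : Type} {F : Ultrafilter I} {N : I → LStructure}

theorem comp_update_out (s : ℕ → (ultraproduct F N).U) (x : ℕ) (u : (ultraproduct F N).U) (i : I) :
    (fun v => (Function.update s x u v).out i) =
      Function.update (fun v => (s v).out i) x (u.out i) := by
  funext v
  by_cases h : v = x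
  · subst h; simp
  · simp [h]

theorem isLStructure_ultraproduct (hN : ∀ i, IsLStructure (N i)) :
    IsLStructure (ultraproduct F N) := by
  refine ⟨fun φ s t h => ?_, fun φ ψ s h => ?_, fun φ x y s h => ?_⟩
  · exact Filter.eventually_congr (.of_forall fun i => (hN i).1 φ _ _ fun p hp => by rw [h p hp])
  · exact Filter.eventually_congr (.of_forall fun i => (hN i).2.1 φ ψ _ h)
  · refine Filter.eventually_congr (.of_forall fun i => ?_)
    rw [(hN i).2.2 φ x y _ h, comp_update_out]

theorem eventually_out_mk (f : ∀ i, (N i).U) :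
    ∀ᶠ i in F, (Quotient.mk _ f : (ultraproduct F N).U).out i = f i :=
  Quotient.mk_out (s := (F : Filter I).productSetoid fun i => (N i).U) f

theorem evalT_ultraproduct (s : ℕ → (ultraproduct F N).U) (t : LTerm) :
    ∀ᶠ i in F, ((ultraproduct F N).evalT s t).out i = (N i).evalT (fun v => (s v).out i) t := by
  induction t with
  | var n => exact .of_forall fun i => rfl
  | zero => exact eventually_out_mk _
  | succ t ih =>
    filter_upwards [ih, eventually_out_mk (F := F) (N := N)
      fun i => (N i).succ (((ultraproduct F N).evalT s t).out i)] with i h₁ h₂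
    simp only [evalT]
    rw [← h₁]
    exact h₂
  | add t u iht ihu =>
    filter_upwards [iht, ihu, eventually_out_mk (F := F) (N := N)
      fun i => (N i).add (((ultraproduct F N).evalT s t).out i)
        (((ultraproduct F N).evalT s u).out i)] with i h₁ h₂ h₃
    simp only [evalT]
    rw [← h₁, ← h₂]
    exact h₃
  | mul t u iht ihu =>
    filter_upwards [iht, ihu, eventually_out_mk (F := F) (N := N)
      fun i => (N i).mul (((ultraproduct F N).evalT s t).out i)
        (((ultraproduct F N).evalT s u).out i)] with i h₁ h₂ h₃
    simp only [evalT]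
    rw [← h₁, ← h₂]
    exact h₃

theorem eq_iff_eventually_out (a b : (ultraproduct F N).U) :
    a = b ↔ ∀ᶠ i in F, a.out i = b.out i :=
  (Quotient.out_equiv_out (s := (F : Filter I).productSetoid fun i => (N i).U)).symm

/-- The theorem of Łoś on satisfaction in ultraproducts. -/
theorem sat_ultraproduct (s : ℕ → (ultraproduct F N).U) (φ : LFormula) :
    (ultraproduct F N).Sat s φ ↔ ∀ᶠ i in F, (N i).Sat (fun v => (s v).out i) φ := by
  induction φ generalizing s with
  | eq t u =>
    simp only [Sat]
    rw [eq_iff_eventually_out]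
    refine Filter.eventually_congr ?_
    filter_upwards [evalT_ultraproduct s t, evalT_ultraproduct s u] with i h₁ h₂
    rw [h₁, h₂]
  | falsum => exact ⟨False.elim, fun h => h.exists.choose_spec⟩
  | imp a b iha ihb =>
    simp only [Sat]
    rw [iha, ihb, Ultrafilter.eventually_imp]
  | all x a ih =>
    simp only [Sat]
    constructor
    · intro h
      by_contra hne
      rw [← Ultrafilter.eventually_not] at hne
      have hne' : ∀ᶠ i in F, ∃ u, ¬ (N i).Sat (Function.update (fun v => (s v).out i) x u) a :=
        hne.mono fun i hi => not_forall.1 hi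
      classical
      let f : ∀ i, (N i).U := fun i =>
        if h : ∃ u, ¬ (N i).Sat (Function.update (fun v => (s v).out i) x u) a then h.choose
        else (N i).nonempty.some
      obtain ⟨w, hw⟩ : ∃ w : (ultraproduct F N).U, ∀ᶠ i in F, w.out i = f i :=
        ⟨Quotient.mk _ f, eventually_out_mk f⟩
      obtain ⟨i, hi₁, hi₂, hi₃⟩ := (hne'.and (((ih _).1 (h w)).and hw)).exists
      rw [comp_update_out, hi₃] at hi₂
      simp only [f, dif_pos hi₁] at hi₂
      exact hi₁.choose_spec hi₂
    · intro h u
      rw [ih]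
      filter_upwards [h] with i hi
      rw [comp_update_out]
      exact hi _
  | K a ih => rfl

end Ultraproduct

end LStructure

open LStructure

theorem sat_foldr_imp {M : LStructure} {s : ℕ → M.U} {L : List LFormula} {φ : LFormula} :
    M.Sat s (L.foldr LFormula.imp φ) ↔ ((∀ σ ∈ L, M.Sat s σ) → M.Sat s φ) := by
  induction L with
  | nil => simp
  | cons a L ih => simp [Sat, ih]

/-- Compactness: a consequence of a set of sentences follows from finitely many of them. -/
theorem exists_valid_foldr_imp {T : Set LFormula} (hT : ∀ σ ∈ T, σ.fv = ∅) {φ : LFormula}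
    (h : Consequence T φ) : ∃ L : List LFormula, (∀ σ ∈ L, σ ∈ T) ∧
      Valid (L.foldr LFormula.imp φ) := by
  by_contra! hcon
  have hcounter : ∀ L : Finset T, ∃ (M : LStructure) (s : ℕ → M.U), IsLStructure M ∧
      (∀ σ ∈ L, M.Sat s σ) ∧ ¬ M.Sat s φ := by
    intro L
    have hL := hcon (L.toList.map Subtype.val) (by simp +contextual)
    simp only [Valid, Consequence, Models, not_forall, sat_foldr_imp] at hL
    obtain ⟨M, hM, -, s, hs, hφ⟩ := hL
    exact ⟨M, s, hM, fun σ hσ => hs σ (by simp [hσ]), hφ⟩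
  choose N s hN hs hφ using hcounter
  let F : Ultrafilter (Finset T) := Ultrafilter.of Filter.atTop
  let t : ℕ → (ultraproduct F N).U := fun v => Quotient.mk _ fun L => s L v
  have hsat : ∀ ψ : LFormula, (ultraproduct F N).Sat t ψ ↔ ∀ᶠ L in F, (N L).Sat (s L) ψ := by
    intro ψ
    rw [sat_ultraproduct]
    refine Filter.eventually_congr ?_
    have : ∀ᶠ L in F, ∀ p ∈ ψ.fv, (t p).out L = s L p :=
      (Filter.eventually_all_finset ψ.fv).2 fun p _ =>
        eventually_out_mk (F := F) (N := N) fun L => s L p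
    filter_upwards [this] with L hL
    exact sat_congr (hN L) hL
  have hP := isLStructure_ultraproduct (F := F) hN
  have := h _ hP (fun σ hσ => models_of_sat hP (s := t) (hT σ hσ) ((hsat σ).2 ?_)) t
  · obtain ⟨L, hL⟩ := ((hsat φ).1 this).exists
    exact hφ L hL
  · have hev : ∀ᶠ L in (F : Filter (Finset T)), {⟨σ, hσ⟩} ≤ L :=
      Ultrafilter.of_le _ (Filter.eventually_ge_atTop _)
    refine hev.mono fun L hL => ?_
    exact hs L ⟨σ, hσ⟩ (Finset.singleton_subset_iff.1 hL)

section MSigma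

variable {T : Set LFormula}

theorem isLStructure_MSigma (T : Set LFormula) : IsLStructure (MSigma T) := by
  refine ⟨fun φ s t h => ?_, fun φ ψ s h => ?_, fun φ x y s h => ?_⟩
  · have : instNum s φ = instNum t φ := subst_congr fun p hp => congrArg numeral (h p hp)
    change Consequence T (instNum s φ) ↔ Consequence T (instNum t φ)
    rw [this]
  · exact forall_congr' fun M => forall_congr' fun hM => imp_congr_right fun _ =>
      models_alphaVariant hM (h.instNum s)
  · change Consequence T (instNum s (subst1 x (LTerm.var y) φ)) ↔
      Consequence T (instNum (Function.update s x (s y)) φ)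
    exact iff_of_eq (congrArg _ (instNum_subst1_var h s))

theorem evalT_numeral (s : ℕ → ℕ) (n : ℕ) : (MSigma T).evalT s (numeral n) = n := by
  induction n with
  | zero => rfl
  | succ n ih => exact congrArg Nat.succ ih

theorem evalT_subst (s s' : ℕ → ℕ) {t : LTerm} {τ : ℕ → LTerm}
    (h : ∀ p ∈ t.fv, (MSigma T).evalT s (τ p) = s' p) :
    (MSigma T).evalT s (t.subst τ) = (MSigma T).evalT s' t := by
  induction t with
  | var n => exact h n (by simp [LTerm.fv])
  | zero => rfl
  | succ t ih => exact congrArg Nat.succ (ih h)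
  | add t u iht ihu =>
    simp only [LTerm.fv, Finset.mem_union] at h
    exact congrArg₂ (MSigma T).add (iht fun p hp => h p (Or.inl hp))
      (ihu fun p hp => h p (Or.inr hp))
  | mul t u iht ihu =>
    simp only [LTerm.fv, Finset.mem_union] at h
    exact congrArg₂ (MSigma T).mul (iht fun p hp => h p (Or.inl hp))
      (ihu fun p hp => h p (Or.inr hp))

theorem evalT_eq_of_subst_eq_numeral {s : ℕ → ℕ} {t : LTerm} {m : ℕ}
    (h : (t.subst fun z => numeral (s z)) = numeral m) : (MSigma T).evalT s t = m := by
  rw [← evalT_subst (T := T) s s (t := t) (τ := fun z => numeral (s z))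
    fun p _ => evalT_numeral s (s p), h, evalT_numeral]

theorem sat_subst {s s' : ℕ → ℕ} {φ : LFormula} {τ : ℕ → LTerm} (hτ : NoCapture τ φ)
    (h : ∀ p ∈ φ.fv, ((τ p).subst fun z => numeral (s z)) = numeral (s' p)) :
    (MSigma T).Sat s (φ.subst τ) ↔ (MSigma T).Sat s' φ := by
  induction φ generalizing s s' τ with
  | eq t u =>
    simp only [fv, Finset.mem_union] at h
    simp only [LFormula.subst, Sat]
    rw [evalT_subst s s' fun p hp => evalT_eq_of_subst_eq_numeral (h p (Or.inl hp)),
      evalT_subst s s' fun p hp => evalT_eq_of_subst_eq_numeral (h p (Or.inr hp))]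
  | falsum => rfl
  | imp a b iha ihb =>
    simp only [fv, Finset.mem_union] at h
    exact imp_congr (iha hτ.1 fun p hp => h p (Or.inl hp)) (ihb hτ.2 fun p hp => h p (Or.inr hp))
  | all x a ih =>
    refine forall_congr' fun (u : ℕ) => ih (s := (Function.update s x u : ℕ → ℕ))
      (s' := (Function.update s' x u : ℕ → ℕ)) hτ.2 fun p hp => ?_
    by_cases hx : p = x
    · simp [hx, LTerm.subst]
    · rw [if_neg hx, Function.update_of_ne hx]
      rw [← h p (by simp [fv, hx, hp])]
      refine LTerm.subst_congr fun q hq => ?_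
      have : q ≠ x := fun e => hτ.1 p hp hx (e ▸ hq)
      simp [this]
  | K a ih =>
    change Consequence T (instNum s (a.subst τ)) ↔ Consequence T (instNum s' a)
    have : instNum s (a.subst τ) = instNum s' a := by
      unfold instNum
      rw [LFormula.subst_subst (φ := a) _ hτ]
      exact LFormula.subst_congr h
    rw [this]

theorem sat_instNum (s t : ℕ → ℕ) (φ : LFormula) :
    (MSigma T).Sat t (instNum s φ) ↔ (MSigma T).Sat s φ :=
  sat_subst (noCapture_numeral _ _) fun _ _ => numeral_subst _ _

theorem sat_subst1 {s : ℕ → ℕ} {φ : LFormula} {x : ℕ} {t : LTerm} {m : ℕ} (ht : t.fv ⊆ {x})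
    (hm : (t.subst fun z => numeral (s z)) = numeral m) :
    (MSigma T).Sat s (subst1 x t φ) ↔
      (MSigma T).Sat (Function.update s x m : ℕ → ℕ) φ := by
  refine sat_subst (noCapture_subst1 φ x ht) fun p _ => ?_
  by_cases hx : p = x
  · simp [hx, hm]
  · simp [hx, LTerm.subst]

theorem sat_subst1_numeral (s : ℕ → ℕ) (φ : LFormula) (x m : ℕ) :
    (MSigma T).Sat s (subst1 x (numeral m) φ) ↔
      (MSigma T).Sat (Function.update s x m : ℕ → ℕ) φ :=
  sat_subst1 (by simp [numeral_fv]) (numeral_subst _ _)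

theorem models_PAax {φ : LFormula} (h : PAax φ) : (MSigma T).Models φ := by
  cases h with
  | succ_ne_zero => exact fun s (u : ℕ) => Nat.succ_ne_zero u
  | succ_inj => exact fun s (u v : ℕ) h => Nat.succ_injective h
  | add_zero => exact fun s (u : ℕ) => Nat.add_zero u
  | add_succ => exact fun s (u v : ℕ) => Nat.add_succ u v
  | mul_zero => exact fun s (u : ℕ) => Nat.mul_zero u
  | mul_succ => exact fun s (u v : ℕ) => Nat.mul_succ u v
  | ind φ x =>
    refine models_uclose fun (s : ℕ → ℕ) h₀ hs (u : ℕ) => ?_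
    induction u with
    | zero => exact (sat_subst1_numeral s φ x 0).1 h₀
    | succ u ih =>
      have := (sat_subst1 (s := (Function.update s x u : ℕ → ℕ)) (m := u + 1)
        (by simp [LTerm.fv]) (by simp [LTerm.subst, numeral])).1 (hs u ih)
      rwa [Function.update_idem] at this

theorem sat_stdModel_iff {φ : LFormula} (h : KFree φ) (s : ℕ → ℕ) :
    StdModel.Sat s φ ↔ (MSigma T).Sat s φ := by
  have heval : ∀ (s : ℕ → ℕ) (t : LTerm), StdModel.evalT s t = (MSigma T).evalT s t := by
    intro s t
    induction t with
    | var n => rfl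
    | zero => rfl
    | succ t ih => exact congrArg Nat.succ ih
    | add t u iht ihu => exact congrArg₂ (· + ·) iht ihu
    | mul t u iht ihu => exact congrArg₂ (· * ·) iht ihu
  induction φ generalizing s with
  | eq t u =>
    simp only [Sat]
    rw [heval, heval]
    rfl
  | falsum => rfl
  | imp a b iha ihb => exact imp_congr (iha h.1 s) (ihb h.2 s)
  | all x a ih => exact forall_congr' fun u => ih h _
  | K a ih => exact h.elim

theorem sat_iffF {M : LStructure} {s : ℕ → M.U} {φ ψ : LFormula} :
    M.Sat s (iffF φ ψ) ↔ (M.Sat s φ ↔ M.Sat s ψ) := by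
  simp only [iffF, andF, notF, Sat]
  tauto

end MSigma

section SigmaN

variable {pw : LFormula} {n : ℕ}

theorem fv_line3 (hfv : pw.fv ⊆ {vx, vy, ve}) {φ : LFormula} (hφ : φ.fv ⊆ {vx}) :
    (line3 pw n φ).fv = ∅ := by
  have hsub : (subst1 ve (numeral n) (subst1 vy (numeral φ.gnum) pw)).fv ⊆ {vx} := by
    intro p hp
    obtain ⟨q, hq, hp⟩ := exists_of_mem_fv_subst hp
    obtain ⟨r, hr, hq⟩ := exists_of_mem_fv_subst hq
    have hr := hfv hr
    split_ifs at hp with h₁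
    · simp [numeral_fv] at hp
    split_ifs at hq with h₂
    · simp [numeral_fv] at hq
    simp only [LTerm.fv, Finset.mem_singleton] at hp hq
    subst hp hq
    simpa [h₁, h₂] using hr
  refine Finset.eq_empty_of_forall_notMem fun p hp => ?_
  simp only [line3, iffF, andF, notF, fv, Finset.mem_erase, Finset.mem_union,
    Finset.notMem_empty, or_false] at hp
  obtain ⟨hpx, hp⟩ := hp
  apply hpx
  rw [← Finset.mem_singleton]
  rcases hp with (h | h) | (h | h)
  exacts [hφ h, hsub h, hsub h, hφ h]

theorem SigmaAx.fv_eq_empty (hfv : pw.fv ⊆ {vx, vy, ve}) {σ : LFormula} (h : SigmaAx pw n σ) :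
    σ.fv = ∅ := by
  induction h with
  | e1 h => obtain ⟨φ, _, rfl⟩ := h; exact fv_uclose _
  | e2 h => obtain ⟨φ, ψ, rfl⟩ := h; exact fv_uclose _
  | e4 h => obtain ⟨φ, rfl⟩ := h; exact fv_uclose _
  | pa h =>
    cases h with
    | ind => exact fv_uclose _
    | _ => rfl
  | code φ h => exact fv_line3 hfv h
  | av φ s h => exact fv_instNum s φ
  | k h ih => exact ih

theorem consequence_of_mem {T : Set LFormula} {φ : LFormula} (h : φ ∈ T) : Consequence T φ :=
  fun _ _ hM => hM φ h

/-- The consequences of `Σ(n)` are closed under necessitation. -/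
theorem consequence_K (hfv : pw.fv ⊆ {vx, vy, ve}) {φ : LFormula} (hφ : φ.fv = ∅)
    (h : Consequence (SigmaN pw n) φ) : Consequence (SigmaN pw n) (LFormula.K φ) := by
  obtain ⟨L, hL, hval⟩ := exists_valid_foldr_imp (fun σ hσ => SigmaAx.fv_eq_empty hfv hσ) h
  have hclosed : ∀ L : List LFormula, (∀ σ ∈ L, σ ∈ SigmaN pw n) →
      (L.foldr LFormula.imp φ).fv = ∅ := by
    intro L hL
    induction L with
    | nil => exact hφ
    | cons a L ih =>
      have ha : a.fv = ∅ := SigmaAx.fv_eq_empty hfv (hL a (by simp))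
      simp [fv, ha, ih fun σ hσ => hL σ (by simp [hσ])]
  have hK : Consequence (SigmaN pw n) (LFormula.K (L.foldr LFormula.imp φ)) :=
    consequence_of_mem (SigmaAx.e1 ⟨_, hval, (uclose_of_fv_eq_empty (φ := .K _) (hclosed L hL)).symm⟩)
  clear hval
  induction L with
  | nil => exact hK
  | cons a L ih =>
    have ha := hL a (by simp)
    have hL' : ∀ σ ∈ L, σ ∈ SigmaN pw n := fun σ hσ => hL σ (by simp [hσ])
    refine ih hL' fun M hM hMT s => ?_
    have hE2 : SigmaAx pw n (.imp (.K (.imp a (L.foldr LFormula.imp φ)))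
        (.imp (.K a) (.K (L.foldr LFormula.imp φ)))) :=
      SigmaAx.e2 ⟨a, _, (uclose_of_fv_eq_empty (by
        simp [fv, hclosed L hL', SigmaAx.fv_eq_empty hfv ha])).symm⟩
    exact hMT _ hE2 s (hK M hM hMT s) (hMT _ (SigmaAx.k ha) s)

theorem models_line3 (hfv : pw.fv ⊆ {vx, vy, ve}) (hkf : KFree pw)
    (hcorr : ∀ a b k : ℕ, StdModel.Models (pwNum pw a b k) ↔ Nat.pair a b ∈ W k)
    (hW : W n = goalSet pw n) {φ : LFormula} (hφ : φ.fv ⊆ {vx}) :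
    (MSigma (SigmaN pw n)).Models (line3 pw n φ) := by
  intro (s : ℕ → ℕ) (m : ℕ)
  rw [sat_iffF]
  have hK : (MSigma (SigmaN pw n)).Sat (Function.update s vx m) (LFormula.K φ) ↔
      Nat.pair m φ.gnum ∈ goalSet pw n := by
    have hinst : instNum (Function.update s vx m) φ = subst1 vx (numeral m) φ :=
      subst_congr fun p hp => by
        have : p = vx := by simpa using hφ hp
        simp [this]
    change Consequence _ (instNum (Function.update s vx m) φ) ↔ _
    rw [hinst]
    constructor
    · exact fun h => ⟨m, φ, rfl, hφ, h⟩
    · rintro ⟨m', φ', he, -, h⟩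
      rw [Nat.pair_eq_pair] at he
      rwa [he.1, gnum_injective he.2]
  have hpw : StdModel.Models (pwNum pw m φ.gnum n) ↔
      (MSigma (SigmaN pw n)).Sat
        (fun z => if z = vx then m else if z = vy then φ.gnum else n) pw :=
    ⟨fun h => (sat_instNum _ s pw).1 ((sat_stdModel_iff (kFree_subst hkf _) _).1 (h s)),
      fun h t => (sat_stdModel_iff (kFree_subst hkf _) _).2 ((sat_instNum _ _ pw).2 h)⟩
  refine hK.trans ?_
  rw [← hW, ← hcorr, hpw]
  refine Iff.trans ?_ (sat_subst1_numeral _ _ _ _).symm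
  refine Iff.trans ?_ (sat_subst1_numeral _ _ _ _).symm
  refine sat_congr (isLStructure_MSigma _) fun p hp => ?_
  have hp := hfv hp
  simp only [Finset.mem_insert, Finset.mem_singleton] at hp
  rcases hp with rfl | rfl | rfl <;> rfl

end SigmaN

/-- Let n satisfy W_n = { ⟨m, ⌜φ⌝⟩ : φ with free variables ⊆ {x} and
Σ(n) ⊨ φ(x|m̄) }.  Then M_(Σ(n)) ⊨ σ for every σ ∈ Σ(n). -/
theorem MSigmaN_satisfies_SigmaN (pw : LFormula) (hfv : pw.fv ⊆ {vx, vy, ve}) (hkf : KFree pw)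
    (hcorr : ∀ a b k : ℕ, StdModel.Models (pwNum pw a b k) ↔ Nat.pair a b ∈ W k)
    (n : ℕ) (hW : W n = goalSet pw n) :
    ∀ σ ∈ SigmaN pw n, (MSigma (SigmaN pw n)).Models σ := by
  intro σ hσ
  have hM := isLStructure_MSigma (SigmaN pw n)
  induction hσ with
  | e1 h =>
    obtain ⟨φ, hφ, rfl⟩ := h
    exact models_uclose fun s => consequence_of_mem (SigmaAx.av φ s hφ)
  | e2 h =>
    obtain ⟨φ, ψ, rfl⟩ := h
    exact models_uclose fun s hi ha N hN hNT t => hi N hN hNT t (ha N hN hNT t)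
  | e4 h =>
    obtain ⟨φ, rfl⟩ := h
    exact models_uclose fun s h => consequence_K hfv (fv_instNum s φ) h
  | pa h => exact models_PAax h
  | code φ h => exact models_line3 hfv hkf hcorr hW h
  | av φ s h => exact fun t => (sat_instNum s t φ).2 (h _ hM (by simp) s)
  | @k φ h _ =>
    intro s
    have h' : Consequence (SigmaN pw n) φ := consequence_of_mem h
    rwa [← instNum_of_fv_eq_empty (h.fv_eq_empty hfv) s] at h'
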